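/- The dual of a staircase multisegment is the transposed staircase: for every a ∈ ℝ and all integers l, k ≥ 1, one has M(a; l, k)^# = M(a; k, l). (This is the combinatorial content, via the Moeglin–Waldspurger algorithm, of the statement that the dual of the Speh representation u(Z(ρ,l),k) is u(Z(ρ,k),l).) -/

import Mathlib

open scoped Classical

noncomputable section

/-- The segment `{a, a+1, ..., a+m-1}` as a finite set of reals. -/
def finsetSeg (a : ℝ) (m : ℕ) : Finset ℝ :=
  (Finset.range m).image (fun i => a + i)

/-- A segment is a nonempty subset of `ℝ` of the form `{a, a+1, ..., a+m-1}` with `m ≥ 1`. -/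
def IsSegment (S : Finset ℝ) : Prop :=
  ∃ (a : ℝ) (m : ℕ), 1 ≤ m ∧ S = finsetSeg a m

/-- A multisegment is a nonempty finite multiset of segments. -/
def IsMultisegment (M : Multiset (Finset ℝ)) : Prop :=
  M ≠ 0 ∧ ∀ S ∈ M, IsSegment S

/-- The beginning (smallest element) of a segment. -/
def beg (S : Finset ℝ) : ℝ := if h : S.Nonempty then S.min' h else 0

/-- The ending (largest element) of a segment. -/
def endg (S : Finset ℝ) : ℝ := if h : S.Nonempty then S.max' h else 0

/-- Two segments are linked if neither is included in the other and their union is a segment. -/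
def Linked (S₁ S₂ : Finset ℝ) : Prop :=
  ¬ S₁ ⊆ S₂ ∧ ¬ S₂ ⊆ S₁ ∧ IsSegment (S₁ ∪ S₂)

/-- `ElemOp M N` means that `N` is obtained from `M` by an elementary operation:
a pair of linked segments `S₁, S₂` of `M` is replaced by `S₁ ∪ S₂, S₁ ∩ S₂`,
the intersection being omitted when empty. -/
def ElemOp (M N : Multiset (Finset ℝ)) : Prop :=
  ∃ (S₁ S₂ : Finset ℝ) (rest : Multiset (Finset ℝ)),
    Linked S₁ S₂ ∧ M = S₁ ::ₘ S₂ ::ₘ rest ∧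
    N = (if S₁ ∩ S₂ = ∅ then (S₁ ∪ S₂) ::ₘ rest
         else (S₁ ∪ S₂) ::ₘ (S₁ ∩ S₂) ::ₘ rest)

/-- `msLE M M'` (i.e. `M ≤ M'`) : `M` is obtained from `M'` by a finite (possibly empty)
sequence of elementary operations. -/
def msLE (M M' : Multiset (Finset ℝ)) : Prop :=
  Relation.ReflTransGen ElemOp M' M

/-- The support of a multisegment: the multiset union of its segments. -/
def suppM (M : Multiset (Finset ℝ)) : Multiset ℝ :=
  (M.map Finset.val).sum

/-- The maxlength `m(M)`: the maximal length of the segments of `M`. -/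
def maxLen (M : Multiset (Finset ℝ)) : ℕ :=
  (M.map Finset.card).sup

/-- The thickness `t(M)`: the number of segments of `M`, counted with multiplicity. -/
def thickness (M : Multiset (Finset ℝ)) : ℕ := Multiset.card M

/-- The largest element of `E(M)`, the multiset of endings of the segments of `M`. -/
def maxEnd (M : Multiset (Finset ℝ)) : ℝ :=
  ((M.map endg).toFinset.max).unbotD 0

/-- The candidate segments of `M` with ending `x` which are not included in `prev`. -/
def cands (M : Multiset (Finset ℝ)) (x : ℝ) (prev : Finset ℝ) : Finset (Finset ℝ) :=
  M.toFinset.filter (fun S => endg S = x ∧ ¬ S ⊆ prev)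

/-- A shortest element of a finite collection of finite sets (junk value `∅` if empty).
In the Moeglin-Waldspurger algorithm the candidate sets consist of segments with a
common ending, so a shortest candidate is unique and this choice is canonical. -/
def chooseMin (C : Finset (Finset ℝ)) : Finset ℝ :=
  if h : C.Nonempty then (Finset.exists_min_image C Finset.card h).choose else ∅

/-- The chain `δ₀, δ₁, δ₂, ...` of the Moeglin-Waldspurger algorithm: `δ₀` is a shortest
segment of `M` with ending `x` (the maximal ending), and `δ_i` is a shortest segment of
`M` with ending `x - i` not included in `δ_{i-1}`; the construction stops when no such
segment exists.  The first argument is fuel (the chain has length at most `card M`). -/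
def mwChainAux (M : Multiset (Finset ℝ)) : ℕ → ℝ → Finset ℝ → List (Finset ℝ)
  | 0, _, _ => []
  | n + 1, x, prev =>
      if (cands M x prev).Nonempty then
        chooseMin (cands M x prev) :: mwChainAux M n (x - 1) (chooseMin (cands M x prev))
      else []

/-- The chain `δ₀, δ₁, ..., δ_r` of the Moeglin-Waldspurger algorithm for `M`. -/
def mwChain (M : Multiset (Finset ℝ)) : List (Finset ℝ) :=
  mwChainAux M (Multiset.card M) (maxEnd M) ∅

/-- The first segment `S₀ = {e-r, ..., e}` of `M^#`, where `e = maxEnd M` and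
`r + 1` is the length of the chain. -/
def firstSeg (M : Multiset (Finset ℝ)) : Finset ℝ :=
  finsetSeg (maxEnd M - (((mwChain M).length - 1 : ℕ) : ℝ)) (mwChain M).length

/-- `δ⁻`: the segment `δ` with its ending removed. -/
def segMinus (S : Finset ℝ) : Finset ℝ := S.erase (endg S)

/-- `M⁻`: the multisegment obtained from `M` by replacing each `δ_i` of the chain by
`δ_i⁻`, erasing it if it becomes empty. -/
def msMinus (M : Multiset (Finset ℝ)) : Multiset (Finset ℝ) :=
  (mwChain M).foldl
    (fun N δ => if segMinus δ = ∅ then N.erase δ else segMinus δ ::ₘ N.erase δ) M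

/-- Fuelled version of the Moeglin-Waldspurger algorithm.  Each round extracts the first
segment `S₀` and recurses on `M⁻`; on a genuine multisegment each round strictly decreases
the cardinality of the support, so fuel `card (suppM M)` always suffices. -/
def mwaAux : ℕ → Multiset (Finset ℝ) → Multiset (Finset ℝ)
  | 0, _ => 0
  | n + 1, M => if M = 0 then 0 else firstSeg M ::ₘ mwaAux n (msMinus M)

/-- The Moeglin-Waldspurger algorithm `M ↦ M^#`. -/
def mwa (M : Multiset (Finset ℝ)) : Multiset (Finset ℝ) :=
  mwaAux (Multiset.card (suppM M)) M

/-- The staircase multisegment `M(a; l, k)`: the `k` segments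
`{a+i, a+i+1, ..., a+i+l-1}` for `i = 1, ..., k` (`k` segments of length `l`,
each a shift by `1` of the previous one). -/
def staircase (a : ℝ) (l k : ℕ) : Multiset (Finset ℝ) :=
  (Multiset.range k).map (fun i => finsetSeg (a + i + 1) l)

theorem finsetSeg_eq_image (b : ℝ) (m : ℕ) :
    finsetSeg b m = (Finset.range m).image (fun i : ℕ => b + (i : ℝ)) := by
  ext x
  simp [finsetSeg, eq_neg_add_iff_add_eq]

theorem mem_finsetSeg {b x : ℝ} {m : ℕ} : x ∈ finsetSeg b m ↔ ∃ i < m, b + (i : ℝ) = x := by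
  rw [finsetSeg_eq_image, Finset.mem_image]
  simp only [Finset.mem_range]

theorem card_finsetSeg (b : ℝ) (m : ℕ) : (finsetSeg b m).card = m := by
  rw [finsetSeg_eq_image, Finset.card_image_of_injective _ (fun i j h => by simpa using h),
    Finset.card_range]

theorem finsetSeg_succ (b : ℝ) (m : ℕ) :
    finsetSeg b (m + 1) = insert (b + (m : ℝ)) (finsetSeg b m) := by
  simp [finsetSeg_eq_image, Finset.range_add_one, Finset.image_insert]

theorem endg_finsetSeg_succ (b : ℝ) (m : ℕ) : endg (finsetSeg b (m + 1)) = b + m := by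
  have hmem : b + (m : ℝ) ∈ finsetSeg b (m + 1) := mem_finsetSeg.2 ⟨m, by omega, rfl⟩
  rw [endg, dif_pos ⟨_, hmem⟩]
  refine le_antisymm (Finset.max'_le _ _ _ fun x hx => ?_) (Finset.le_max' _ _ hmem)
  obtain ⟨i, hi, rfl⟩ := mem_finsetSeg.1 hx
  have : (i : ℝ) ≤ m := by exact_mod_cast Nat.lt_succ_iff.1 hi
  linarith

theorem segMinus_finsetSeg_succ (b : ℝ) (m : ℕ) :
    segMinus (finsetSeg b (m + 1)) = finsetSeg b m := by
  rw [segMinus, endg_finsetSeg_succ, finsetSeg_succ, Finset.erase_insert]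
  intro h
  obtain ⟨i, hi, h⟩ := mem_finsetSeg.1 h
  have : i = m := by exact_mod_cast add_left_cancel h
  omega

theorem finsetSeg_not_subset_of_lt {b c : ℝ} (h : b < c) (m n : ℕ) :
    ¬ finsetSeg b (m + 1) ⊆ finsetSeg c n := by
  intro hs
  obtain ⟨i, -, hi⟩ := mem_finsetSeg.1 (hs (mem_finsetSeg.2 ⟨0, by omega, rfl⟩))
  have : (0 : ℝ) ≤ i := i.cast_nonneg
  push_cast at hi
  linarith

theorem chooseMin_singleton (S : Finset ℝ) : chooseMin {S} = S := by
  have h : ({S} : Finset (Finset ℝ)).Nonempty := Finset.singleton_nonempty S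
  rw [chooseMin, dif_pos h]
  exact Finset.mem_singleton.1 (Finset.exists_min_image {S} Finset.card h).choose_spec.1

theorem mem_staircase {a : ℝ} {l k : ℕ} {S : Finset ℝ} :
    S ∈ staircase a l k ↔ ∃ i < k, finsetSeg (a + (i : ℝ) + 1) l = S := by
  simp [staircase]

theorem staircase_succ (a : ℝ) (l k : ℕ) :
    staircase a l (k + 1) = finsetSeg (a + (k : ℝ) + 1) l ::ₘ staircase a l k := by
  simp [staircase, Multiset.range_succ]

theorem card_staircase (a : ℝ) (l k : ℕ) : Multiset.card (staircase a l k) = k := by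
  simp [staircase]

theorem card_suppM_staircase (a : ℝ) (l k : ℕ) :
    Multiset.card (suppM (staircase a l k)) = k * l := by
  induction k with
  | zero => simp [suppM, staircase]
  | succ k ih =>
    rw [suppM] at ih ⊢
    rw [staircase_succ, Multiset.map_cons, Multiset.sum_cons, Multiset.card_add, ih,
      Finset.card_val, card_finsetSeg]
    ring

theorem maxEnd_staircase (a : ℝ) (l k : ℕ) :
    maxEnd (staircase a (l + 1) (k + 1)) = a + ((k + 1 : ℕ) : ℝ) + l := by
  have hmax : ((staircase a (l + 1) (k + 1)).map endg).toFinset.max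
      = ((a + ((k + 1 : ℕ) : ℝ) + l : ℝ) : WithBot ℝ) := by
    refine le_antisymm (Finset.max_le fun x hx => ?_) (Finset.le_max ?_)
    · obtain ⟨S, hS, rfl⟩ := Multiset.mem_map.1 (Multiset.mem_toFinset.1 hx)
      obtain ⟨i, hi, rfl⟩ := mem_staircase.1 hS
      rw [endg_finsetSeg_succ, WithBot.coe_le_coe]
      have : (i : ℝ) ≤ k := by exact_mod_cast Nat.lt_succ_iff.1 hi
      push_cast
      linarith
    · refine Multiset.mem_toFinset.2 (Multiset.mem_map.2
        ⟨_, mem_staircase.2 ⟨k, by omega, rfl⟩, ?_⟩)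
      rw [endg_finsetSeg_succ]
      push_cast
      ring
  rw [maxEnd, hmax, WithBot.unbotD_coe]

/-- The segments of a staircase, listed by decreasing endings. -/
def staircaseList (a : ℝ) (l : ℕ) : ℕ → List (Finset ℝ)
  | 0 => []
  | k + 1 => finsetSeg (a + (k : ℝ) + 1) l :: staircaseList a l k

theorem coe_staircaseList (a : ℝ) (l k : ℕ) :
    (staircaseList a l k : Multiset (Finset ℝ)) = staircase a l k := by
  induction k with
  | zero => simp [staircaseList, staircase]
  | succ k ih => rw [staircase_succ, ← ih, staircaseList, Multiset.cons_coe]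

theorem length_staircaseList (a : ℝ) (l k : ℕ) : (staircaseList a l k).length = k := by
  induction k with
  | zero => rfl
  | succ k ih => simp [staircaseList, ih]

theorem cands_staircase_succ (a : ℝ) (l : ℕ) {j k : ℕ} (hj : j < k) {prev : Finset ℝ}
    (hprev : ¬ finsetSeg (a + (j : ℝ) + 1) (l + 1) ⊆ prev) :
    cands (staircase a (l + 1) k) (a + ((j + 1 : ℕ) : ℝ) + l) prev
      = {finsetSeg (a + (j : ℝ) + 1) (l + 1)} := by
  ext S
  rw [cands, Finset.mem_filter, Multiset.mem_toFinset, mem_staircase, Finset.mem_singleton]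
  constructor
  · rintro ⟨⟨i, -, rfl⟩, he, -⟩
    rw [endg_finsetSeg_succ] at he
    push_cast at he
    have : (i : ℝ) = j := by linarith
    rw [this]
  · rintro rfl
    refine ⟨⟨j, hj, rfl⟩, ?_, hprev⟩
    rw [endg_finsetSeg_succ]
    push_cast
    ring

theorem cands_staircase_zero (a : ℝ) (l k : ℕ) (prev : Finset ℝ) :
    cands (staircase a (l + 1) k) (a + ((0 : ℕ) : ℝ) + l) prev = ∅ := by
  refine Finset.filter_eq_empty_iff.2 fun S hS => ?_
  obtain ⟨i, -, rfl⟩ := mem_staircase.1 (Multiset.mem_toFinset.1 hS)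
  rintro ⟨he, -⟩
  rw [endg_finsetSeg_succ] at he
  have : (0 : ℝ) ≤ i := i.cast_nonneg
  push_cast at he
  linarith

theorem mwChainAux_staircase (a : ℝ) (l k : ℕ) {j n : ℕ} (hjk : j ≤ k) (hjn : j ≤ n)
    {prev : Finset ℝ} (hprev : ∀ i < j, ¬ finsetSeg (a + (i : ℝ) + 1) (l + 1) ⊆ prev) :
    mwChainAux (staircase a (l + 1) k) n (a + (j : ℝ) + l) prev
      = staircaseList a (l + 1) j := by
  induction j generalizing n prev with
  | zero =>
    cases n with
    | zero => rfl
    | succ n => rw [mwChainAux, cands_staircase_zero, if_neg (by simp), staircaseList]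
  | succ j ih =>
    obtain ⟨n, rfl⟩ : ∃ m, n = m + 1 := ⟨n - 1, by omega⟩
    have hx : a + ((j + 1 : ℕ) : ℝ) + l - 1 = a + j + l := by
      push_cast
      ring
    rw [mwChainAux, cands_staircase_succ a l hjk (hprev j j.lt_succ_self),
      if_pos (Finset.singleton_nonempty _), chooseMin_singleton, hx, staircaseList,
      ih (by omega) (by omega)]
    intro i hi
    have : (i : ℝ) < j := by exact_mod_cast hi
    exact finsetSeg_not_subset_of_lt (by linarith) _ _

theorem mwChain_staircase (a : ℝ) (l k : ℕ) :
    mwChain (staircase a (l + 1) (k + 1)) = staircaseList a (l + 1) (k + 1) := by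
  rw [mwChain, maxEnd_staircase, card_staircase]
  refine mwChainAux_staircase a l _ le_rfl le_rfl fun i _ h => ?_
  have := Finset.card_le_card h
  simp [card_finsetSeg] at this

theorem firstSeg_staircase (a : ℝ) (l k : ℕ) :
    firstSeg (staircase a (l + 1) (k + 1)) = finsetSeg (a + (l : ℝ) + 1) (k + 1) := by
  rw [firstSeg, mwChain_staircase, length_staircaseList, maxEnd_staircase]
  congr 1
  push_cast [Nat.add_sub_cancel]
  ring

theorem foldl_segMinus (L : List (Finset ℝ)) (N : Multiset (Finset ℝ)) :
    L.foldl (fun N δ => if segMinus δ = ∅ then N.erase δ else segMinus δ ::ₘ N.erase δ)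
        (N + (L : Multiset (Finset ℝ)))
      = N + ((L : Multiset (Finset ℝ)).map segMinus).filter (· ≠ ∅) := by
  induction L generalizing N with
  | nil => simp
  | cons δ L ih =>
    have herase : (N + ((δ :: L : List (Finset ℝ)) : Multiset (Finset ℝ))).erase δ
        = N + (L : Multiset (Finset ℝ)) := by
      rw [← Multiset.cons_coe, Multiset.add_cons, Multiset.erase_cons_head]
    rw [List.foldl_cons, herase, ← Multiset.cons_coe, Multiset.map_cons]
    by_cases h : segMinus δ = ∅
    · rw [if_pos h, ih, Multiset.filter_cons_of_neg _ (by simpa using h)]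
    · rw [if_neg h, ← Multiset.cons_add, ih, Multiset.filter_cons_of_pos (p := (· ≠ ∅)) _ h,
        Multiset.cons_add, Multiset.add_cons]

theorem msMinus_staircase (a : ℝ) (l k : ℕ) :
    msMinus (staircase a (l + 1) (k + 1)) = (staircase a l (k + 1)).filter (· ≠ ∅) := by
  have h := foldl_segMinus (staircaseList a (l + 1) (k + 1)) 0
  rw [zero_add, zero_add, coe_staircaseList] at h
  rw [msMinus, mwChain_staircase, h]
  simp only [staircase, Multiset.map_map, Function.comp_def, segMinus_finsetSeg_succ]

theorem filter_ne_empty_staircase (a : ℝ) (l k : ℕ) :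
    (staircase a (l + 1) k).filter (· ≠ ∅) = staircase a (l + 1) k := by
  refine Multiset.filter_eq_self.2 fun S hS => ?_
  obtain ⟨i, -, rfl⟩ := mem_staircase.1 hS
  exact Finset.ne_empty_of_mem (mem_finsetSeg.2 ⟨0, by omega, rfl⟩)

theorem mwaAux_zero (n : ℕ) : mwaAux n 0 = 0 := by
  cases n <;> simp [mwaAux]

theorem mwaAux_staircase (a : ℝ) (k : ℕ) {l n : ℕ} (h : l ≤ n) :
    mwaAux n ((staircase a l (k + 1)).filter (· ≠ ∅)) = staircase a (k + 1) l := by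
  induction l generalizing n with
  | zero =>
    have hempty : (staircase a 0 (k + 1)).filter (· ≠ ∅) = 0 := by
      refine Multiset.filter_eq_nil.2 fun S hS => ?_
      obtain ⟨i, -, rfl⟩ := mem_staircase.1 hS
      simp [finsetSeg]
    rw [hempty, mwaAux_zero]
    rfl
  | succ l ih =>
    obtain ⟨n, rfl⟩ : ∃ m, n = m + 1 := ⟨n - 1, by omega⟩
    have hne : staircase a (l + 1) (k + 1) ≠ 0 := by
      rw [staircase_succ]
      exact Multiset.cons_ne_zero
    rw [filter_ne_empty_staircase, mwaAux, if_neg hne, firstSeg_staircase, msMinus_staircase, ih (by omega),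
      ← staircase_succ]

/-- The dual of a staircase multisegment is the transposed staircase:
`M(a; l, k)^# = M(a; k, l)`. -/
theorem mwa_staircase (a : ℝ) (l k : ℕ) (hl : 1 ≤ l) (hk : 1 ≤ k) :
    mwa (staircase a l k) = staircase a k l := by
  obtain ⟨l, rfl⟩ : ∃ m, l = m + 1 := ⟨l - 1, by omega⟩
  obtain ⟨k, rfl⟩ : ∃ m, k = m + 1 := ⟨k - 1, by omega⟩
  rw [mwa, card_suppM_staircase, ← filter_ne_empty_staircase,
    mwaAux_staircase a k (Nat.le_mul_of_pos_left _ k.succ_pos)]
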